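/- arXiv:1905.07377 — 7 statements merged into one kernel-verified Lean document; each statement's English description precedes it below -/
import Mathlib

section
/- Let ε > 0, let γ_ε : [−ε, ε] → [0,1] be a continuous strictly decreasing function such that the function Γ_ε : ℝ → [0,1] defined by Γ_ε(y) = 1 for y ≤ −ε, Γ_ε(y) = γ_ε(y) for −ε < y < ε, and Γ_ε(y) = 0 for y ≥ ε is differentiable. Let α ∈ (0,1) and N ∈ ℕ with (1−α)·N ∉ ℤ. Then for every z ∈ ℝ^N there exists a unique Q ∈ ℝ such that Σ_{i=1}^N Γ_ε(z_i − Q) = (1−α)·N. -/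
/-- A function equal to `1` left of `-ε`, to `0` right of `ε` and strictly decreasing in between
decreases strictly between any two points, unless it takes the value `1` or the value `0` at
both of them. -/
theorem lt_or_eq_one_or_eq_zero_of_lt {ε : ℝ} (hε : 0 < ε) {Γ : ℝ → ℝ}
    (hone : ∀ y : ℝ, y ≤ -ε → Γ y = 1) (hzero : ∀ y : ℝ, ε ≤ y → Γ y = 0)
    (hanti : StrictAntiOn Γ (Set.Icc (-ε) ε)) {x y : ℝ} (hxy : x < y) :
    Γ y < Γ x ∨ (Γ x = 1 ∧ Γ y = 1) ∨ (Γ x = 0 ∧ Γ y = 0) := by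
  rcases le_or_gt y (-ε) with hy | hy
  · exact Or.inr (Or.inl ⟨hone x (hxy.le.trans hy), hone y hy⟩)
  rcases le_or_gt ε x with hx | hx
  · exact Or.inr (Or.inr ⟨hzero x hx, hzero y (hx.trans hxy.le)⟩)
  left
  have hx' : Γ x = Γ (max x (-ε)) := by
    rcases le_total x (-ε) with h | h
    · rw [max_eq_right h, hone x h, hone _ le_rfl]
    · rw [max_eq_left h]
  have hy' : Γ y = Γ (min y ε) := by
    rcases le_total ε y with h | h
    · rw [min_eq_right h, hzero y h, hzero _ le_rfl]
    · rw [min_eq_left h]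
  have hε' : -ε < ε := by linarith
  rw [hx', hy']
  exact hanti ⟨le_max_right _ _, max_le hx.le hε'.le⟩ ⟨le_min hy.le hε'.le, min_le_right _ _⟩
    (max_lt (lt_min hxy hx) (lt_min hy hε'))

/-- If `∑ i, Γ (z i - Q)` takes the same value at two points, that value is an integer. -/
theorem exists_int_of_sum_eq_of_lt {ι : Type*} [Fintype ι] {ε : ℝ} (hε : 0 < ε) {Γ : ℝ → ℝ}
    (hone : ∀ y : ℝ, y ≤ -ε → Γ y = 1) (hzero : ∀ y : ℝ, ε ≤ y → Γ y = 0)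
    (hanti : StrictAntiOn Γ (Set.Icc (-ε) ε)) (z : ι → ℝ) {P Q : ℝ} (hPQ : P < Q)
    (h : ∑ i, Γ (z i - P) = ∑ i, Γ (z i - Q)) :
    ∃ k : ℤ, ∑ i, Γ (z i - P) = (k : ℝ) := by
  have key (i : ι) := lt_or_eq_one_or_eq_zero_of_lt hε hone hzero hanti
    (sub_lt_sub_left hPQ (z i))
  have hle : ∀ i ∈ Finset.univ, Γ (z i - P) ≤ Γ (z i - Q) := fun i _ => by
    rcases key i with h | h | h
    · exact h.le
    · rw [h.1, h.2]
    · rw [h.1, h.2]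
  have heq := (Finset.sum_eq_sum_iff_of_le hle).1 h
  have hint (i : ι) : ∃ k : ℤ, Γ (z i - P) = (k : ℝ) := by
    rcases key i with h | h | h
    · exact absurd (heq i (Finset.mem_univ i)) h.ne
    · exact ⟨1, by rw [h.2, Int.cast_one]⟩
    · exact ⟨0, by rw [h.2, Int.cast_zero]⟩
  choose k hk using hint
  exact ⟨∑ i, k i, by simp only [hk, Int.cast_sum]⟩

/-- Uniqueness of the smoothed quantile: if `Γ` is a differentiable
smoothed indicator built from a strictly decreasing `γ : [-ε, ε] → [0,1]`
(so `Γ y = 1` for `y ≤ -ε`, `Γ y = 0` for `y ≥ ε`, `Γ` strictly decreasing on `[-ε, ε]`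
with values in `[0,1]`), `α ∈ (0,1)` and `(1-α)·N ∉ ℤ`, then for every `z ∈ ℝ^N` there
is a unique `Q` with `∑ i, Γ (z i - Q) = (1-α)·N`. -/
theorem smoothed_quantile_exists_unique
    (ε : ℝ) (hε : 0 < ε) (Γ : ℝ → ℝ)
    (hΓone : ∀ y : ℝ, y ≤ -ε → Γ y = 1)
    (hΓzero : ∀ y : ℝ, ε ≤ y → Γ y = 0)
    (hΓrange : ∀ y : ℝ, Γ y ∈ Set.Icc (0 : ℝ) 1)
    (hΓanti : StrictAntiOn Γ (Set.Icc (-ε) ε))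
    (hΓdiff : Differentiable ℝ Γ)
    (α : ℝ) (hα : α ∈ Set.Ioo (0 : ℝ) 1) (N : ℕ)
    (hNotInt : ∀ k : ℤ, (1 - α) * (N : ℝ) ≠ (k : ℝ)) :
    ∀ z : Fin N → ℝ, ∃! Q : ℝ, ∑ i, Γ (z i - Q) = (1 - α) * (N : ℝ) := by
  intro z
  have hz (i : Fin N) : |z i| ≤ ∑ j, |z j| :=
    Finset.single_le_sum (f := fun j => |z j|) (fun j _ => abs_nonneg (z j)) (Finset.mem_univ i)
  have hN : (0 : ℝ) ≤ N := N.cast_nonneg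
  have hcont : Continuous fun Q : ℝ => ∑ i, Γ (z i - Q) :=
    continuous_finsetSum _ fun i _ => hΓdiff.continuous.comp (continuous_const.sub continuous_id)
  have hlow : ∑ i, Γ (z i - (-(∑ j, |z j|) - ε)) = 0 :=
    Finset.sum_eq_zero fun i _ => hΓzero _ (by linarith [neg_abs_le (z i), hz i])
  have hhigh : ∑ i, Γ (z i - (∑ j, |z j| + ε)) = N := by
    rw [Finset.sum_congr rfl fun i _ => hΓone _ (by linarith [le_abs_self (z i), hz i])]
    simp
  obtain ⟨Q, hQ⟩ := mem_range_of_exists_le_of_exists_ge (c := (1 - α) * (N : ℝ)) hcont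
    ⟨_, hlow.trans_le (mul_nonneg (sub_nonneg.2 hα.2.le) hN)⟩
    ⟨_, (mul_le_of_le_one_left hN (by linarith [hα.1])).trans_eq hhigh.symm⟩
  have hne {P R : ℝ} (hPR : P < R) (hP : ∑ i, Γ (z i - P) = (1 - α) * (N : ℝ))
      (hR : ∑ i, Γ (z i - R) = (1 - α) * (N : ℝ)) : False := by
    obtain ⟨k, hk⟩ := exists_int_of_sum_eq_of_lt hε hΓone hΓzero hΓanti z hPR (hP.trans hR.symm)
    exact hNotInt k (hP.symm.trans hk)
  refine ⟨Q, hQ, fun R hR => ?_⟩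
  rcases lt_trichotomy R Q with h | h | h
  · exact (hne h hR hQ).elim
  · exact h
  · exact (hne h hQ hR).elim
end

section
/- Let ε > 0 and let Γ_ε : ℝ → [0,1] satisfy Γ_ε(y) = 1 for y ≤ −ε, Γ_ε(y) = 0 for y ≥ ε, Γ_ε(−y) = 1 − Γ_ε(y) for all y, and Γ_ε(y) > 0 for y ∈ [0, ε). Let Y be a real-valued random variable with probability density function h that is strictly decreasing on (−ε, ε). Then P(Y ≤ 0) − E[Γ_ε(Y)] = ∫_0^ε Γ_ε(y) (h(−y) − h(y)) dy, and this quantity is strictly positive. -/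
open MeasureTheory

/-- The law of the unconscious statistician for a random variable with a Lebesgue density. -/
theorem integral_comp_eq_integral_density_mul
    {Ω : Type*} [MeasurableSpace Ω] {μ : Measure Ω}
    {Y : Ω → ℝ} (hY : Measurable Y) {h f : ℝ → ℝ} (hh : Measurable h) (hh0 : ∀ y, 0 ≤ h y)
    (hf : Measurable f)
    (hdensity : Measure.map Y μ = volume.withDensity fun y => ENNReal.ofReal (h y)) :
    ∫ ω, f (Y ω) ∂μ = ∫ y, h y * f y := by
  rw [← integral_map hY.aemeasurable hf.aestronglyMeasurable, hdensity,
    integral_withDensity_eq_integral_toReal_smul hh.ennreal_ofReal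
      (Filter.Eventually.of_forall fun _ => ENNReal.ofReal_lt_top)]
  simp [ENNReal.toReal_ofReal, hh0]

/-- A Lebesgue density of a random variable under a finite measure is integrable. -/
theorem integrable_of_map_eq_withDensity
    {Ω : Type*} [MeasurableSpace Ω] {μ : Measure Ω} [IsFiniteMeasure μ]
    {Y : Ω → ℝ} {h : ℝ → ℝ} (hh : Measurable h) (hh0 : ∀ y, 0 ≤ h y)
    (hdensity : Measure.map Y μ = volume.withDensity fun y => ENNReal.ofReal (h y)) :
    Integrable h := by
  refine ⟨hh.aestronglyMeasurable, ?_⟩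
  rw [hasFiniteIntegral_iff_ofReal (Filter.Eventually.of_forall hh0),
    ← setLIntegral_univ, ← withDensity_apply _ MeasurableSet.univ, ← hdensity]
  exact measure_lt_top _ _

/-- Let `Γ_ε : ℝ → [0,1]` be a symmetric smoothed indicator
(`Γ_ε y = 1` for `y ≤ -ε`, `Γ_ε y = 0` for `y ≥ ε`, `Γ_ε(-y) = 1 - Γ_ε(y)`, and
`Γ_ε y > 0` on `[0, ε)`), and let `Y` be a real random variable with density `h`
strictly decreasing on `(-ε, ε)`. Then
`P(Y ≤ 0) - E[Γ_ε(Y)] = ∫_0^ε Γ_ε(y) (h(-y) - h(y)) dy`, and this quantity is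
strictly positive. -/
theorem smoothing_gap_eq_and_pos
    {Ω : Type*} [MeasurableSpace Ω] (μ : Measure Ω) [IsProbabilityMeasure μ]
    (Y : Ω → ℝ) (hY : Measurable Y)
    (ε : ℝ) (hε : 0 < ε)
    (Γ : ℝ → ℝ) (hΓmeas : Measurable Γ)
    (hΓrange : ∀ y : ℝ, Γ y ∈ Set.Icc (0 : ℝ) 1)
    (hΓone : ∀ y : ℝ, y ≤ -ε → Γ y = 1)
    (hΓzero : ∀ y : ℝ, ε ≤ y → Γ y = 0)
    (hΓsymm : ∀ y : ℝ, Γ (-y) = 1 - Γ y)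
    (hΓpos : ∀ y ∈ Set.Ico (0 : ℝ) ε, 0 < Γ y)
    (h : ℝ → ℝ) (hhmeas : Measurable h) (hhnonneg : ∀ y, 0 ≤ h y)
    (hdensity : Measure.map Y μ = volume.withDensity fun y => ENNReal.ofReal (h y))
    (hhanti : StrictAntiOn h (Set.Ioo (-ε) ε)) :
    (μ {ω | Y ω ≤ 0}).toReal - (∫ ω, Γ (Y ω) ∂μ) =
        (∫ y in (0:ℝ)..ε, Γ y * (h (-y) - h y)) ∧
      0 < ∫ y in (0:ℝ)..ε, Γ y * (h (-y) - h y) := by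
  have hh : Integrable h := integrable_of_map_eq_withDensity hhmeas hhnonneg hdensity
  have hΓnorm : ∀ y, ‖Γ y‖ ≤ 1 := fun y => by
    rw [Real.norm_of_nonneg (hΓrange y).1]
    exact (hΓrange y).2
  have hΓint : ∀ {k : ℝ → ℝ}, Integrable k → Integrable fun y => k y * Γ y := fun hk =>
    hk.mul_bdd hΓmeas.aestronglyMeasurable (Filter.Eventually.of_forall hΓnorm)
  have hprob : (μ {ω | Y ω ≤ 0}).toReal = ∫ y in Set.Iic 0, h y := by
    have key := integral_comp_eq_integral_density_mul hY hhmeas hhnonneg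
      (measurable_one.indicator (measurableSet_Iic (a := (0 : ℝ)))) hdensity
    have hset : MeasurableSet {ω | Y ω ≤ 0} := hY measurableSet_Iic
    calc (μ {ω | Y ω ≤ 0}).toReal
        = ∫ ω, {ω | Y ω ≤ 0}.indicator (1 : Ω → ℝ) ω ∂μ := by
          rw [integral_indicator_one hset, measureReal_def]
      _ = ∫ ω, (Set.Iic (0 : ℝ)).indicator (1 : ℝ → ℝ) (Y ω) ∂μ := rfl
      _ = ∫ y in Set.Iic 0, h y := by
          rw [key, ← integral_indicator measurableSet_Iic]
          congr 1 with y
          by_cases hy : y ∈ Set.Iic (0 : ℝ) <;> simp [Set.indicator, hy]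
  have hexp : ∫ ω, Γ (Y ω) ∂μ = (∫ y in Set.Iic 0, h y * Γ y) + ∫ y in Set.Ioi 0, h y * Γ y := by
    rw [integral_comp_eq_integral_density_mul hY hhmeas hhnonneg hΓmeas hdensity,
      ← Set.compl_Iic, integral_add_compl measurableSet_Iic (hΓint hh)]
  have hleft : (∫ y in Set.Iic 0, h y) - ∫ y in Set.Iic 0, h y * Γ y =
      ∫ y in Set.Ioi 0, h (-y) * Γ y := by
    rw [← integral_sub hh.integrableOn (hΓint hh).integrableOn]
    have hneg := integral_comp_neg_Ioi (0 : ℝ) fun y => h y - h y * Γ y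
    rw [neg_zero] at hneg
    rw [← hneg]
    congr 1 with y
    rw [hΓsymm]
    ring
  have hint : Integrable fun y => Γ y * (h (-y) - h y) := by
    simpa only [mul_comm, Pi.sub_apply] using hΓint (hh.comp_neg.sub hh)
  refine ⟨?_, ?_⟩
  · rw [hprob, hexp, ← sub_sub, hleft,
      ← integral_sub (hΓint hh.comp_neg).integrableOn (hΓint hh).integrableOn,
      intervalIntegral.integral_of_le hε.le]
    trans ∫ y in Set.Ioi 0, Γ y * (h (-y) - h y)
    · congr 1 with y
      ring
    · refine setIntegral_eq_of_subset_of_forall_sdiff_eq_zero measurableSet_Ioi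
        Set.Ioc_subset_Ioi_self fun y hy => ?_
      rw [hΓzero y (not_lt.1 fun hlt => hy.2 ⟨hy.1, hlt.le⟩), zero_mul]
  · refine intervalIntegral.intervalIntegral_pos_of_pos_on hint.intervalIntegrable
      (fun y hy => ?_) hε
    refine mul_pos (hΓpos y ⟨hy.1.le, hy.2⟩) (sub_pos.2 (hhanti ?_ ?_ ?_))
    · exact ⟨by linarith [hy.2], by linarith [hy.1]⟩
    · exact ⟨by linarith [hy.1], hy.2⟩
    · linarith [hy.1]
end

section
/- Let ε > 0 and let Γ_ε be the quartic-kernel smoothed indicator: Γ_ε(y) = 1 for y ≤ −ε, Γ_ε(y) = (15/16)(−(1/5)(y/ε)^5 + (2/3)(y/ε)^3 − (y/ε) + 8/15) for −ε < y < ε, and Γ_ε(y) = 0 for y ≥ ε. Let Y be a real-valued random variable with probability density function h, and suppose there exist m₁, m₂ > 0 such that h(y) ≥ −m₁ y + h(0) for all y ∈ (−ε, 0] and h(y) ≤ −m₂ y + h(0) for all y ∈ [0, ε). Then P(Y ≤ 0) − E[Γ_ε(Y)] ≥ (m₁ + m₂) ε² / 28. -/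
open MeasureTheory

/-- The quartic-kernel smoothed indicator function `Γ_ε`. -/
noncomputable def quarticInd (ε : ℝ) (y : ℝ) : ℝ :=
  if y ≤ -ε then 1
  else if y < ε then (15/16) * (-(1/5) * (y/ε)^5 + (2/3) * (y/ε)^3 - (y/ε) + 8/15)
  else 0

/-- The quartic-kernel smoothed indicator in the rescaled variable `t = y / ε`, for `|t| ≤ 1`. -/
noncomputable def quarticPoly (t : ℝ) : ℝ :=
  (15/16) * (-(1/5) * t^5 + (2/3) * t^3 - t + 8/15)

lemma quarticPoly_eq (t : ℝ) : quarticPoly t = (1 - t)^3 * (8 + 9 * t + 3 * t^2) / 16 := by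
  unfold quarticPoly; ring

lemma one_sub_quarticPoly (t : ℝ) : 1 - quarticPoly t = quarticPoly (-t) := by
  unfold quarticPoly; ring

lemma quarticPoly_nonneg {t : ℝ} (ht : t ≤ 1) : 0 ≤ quarticPoly t := by
  rw [quarticPoly_eq]
  have h₁ : 0 ≤ 1 - t := by linarith
  have h₂ : 0 ≤ 8 + 9 * t + 3 * t^2 := by nlinarith [sq_nonneg (2 * t + 3)]
  positivity

lemma quarticPoly_le_one {t : ℝ} (ht : -1 ≤ t) : quarticPoly t ≤ 1 := by
  have := quarticPoly_nonneg (t := -t) (by linarith)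
  rw [← one_sub_quarticPoly] at this
  linarith

lemma quarticInd_eq_quarticPoly {ε y : ℝ} (hε : 0 < ε) (h₁ : -ε < y) (h₂ : y ≤ ε) :
    quarticInd ε y = quarticPoly (y / ε) := by
  rcases h₂.lt_or_eq with h₂ | rfl
  · simp [quarticInd, quarticPoly, h₁, h₂]
  · rw [div_self hε.ne']
    simp only [quarticInd, quarticPoly, h₁.not_ge, lt_irrefl, if_false]
    norm_num

lemma quarticInd_of_le {ε y : ℝ} (hy : y ≤ -ε) : quarticInd ε y = 1 := by
  simp [quarticInd, hy]

lemma quarticInd_of_lt {ε y : ℝ} (hε : 0 < ε) (hy : ε < y) : quarticInd ε y = 0 := by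
  simp only [quarticInd, hy.not_gt, (show ¬ y ≤ -ε by linarith), if_false]

lemma quarticInd_mem_Icc {ε : ℝ} (hε : 0 < ε) (y : ℝ) : quarticInd ε y ∈ Set.Icc (0 : ℝ) 1 := by
  rcases le_or_gt y (-ε) with h₁ | h₁
  · simp [quarticInd_of_le h₁]
  rcases lt_or_ge ε y with h₂ | h₂
  · simp [quarticInd_of_lt hε h₂]
  rw [quarticInd_eq_quarticPoly hε h₁ h₂]
  refine ⟨quarticPoly_nonneg ?_, quarticPoly_le_one ?_⟩
  · rwa [div_le_one hε]
  · rw [le_div_iff₀ hε]; linarith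

lemma measurable_quarticInd (ε : ℝ) : Measurable (quarticInd ε) := by
  unfold quarticInd
  refine Measurable.ite measurableSet_Iic measurable_const
    (Measurable.ite measurableSet_Iio ?_ measurable_const)
  fun_prop

lemma integral_quarticPoly_mul {ε : ℝ} (hε : 0 < ε) (a m : ℝ) :
    ∫ y in 0..ε, quarticPoly (y / ε) * (-m * y + a) =
      5 / 32 * a * ε - m * ε^2 / 28 := by
  have hd (y : ℝ) : HasDerivAt
      (fun y => ε * ((15/16) * (-m * ε * (-(1/35) * (y/ε)^7 + (2/15) * (y/ε)^5 - (1/3) * (y/ε)^3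
        + (4/15) * (y/ε)^2) + a * (-(1/30) * (y/ε)^6 + (1/6) * (y/ε)^4 - (1/2) * (y/ε)^2
        + (8/15) * (y/ε))))) (quarticPoly (y / ε) * (-m * y + a)) y := by
    have ht : HasDerivAt (fun y : ℝ => y / ε) (1 / ε) y := (hasDerivAt_id y).div_const ε
    have key := ((((((ht.pow 7).const_mul (-(1/35))).add ((ht.pow 5).const_mul (2/15))).sub
      ((ht.pow 3).const_mul (1/3))).add ((ht.pow 2).const_mul (4/15))).const_mul (-m * ε)).add
      ((((((ht.pow 6).const_mul (-(1/30))).add ((ht.pow 4).const_mul (1/6))).sub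
      ((ht.pow 2).const_mul (1/2))).add (ht.const_mul (8/15))).const_mul a)
    refine ((key.const_mul (15/16)).const_mul ε).congr_deriv ?_
    obtain ⟨t, rfl⟩ : ∃ t, y = t * ε := ⟨y / ε, by field_simp⟩
    simp only [quarticPoly, mul_div_cancel_right₀ _ hε.ne', Nat.cast_ofNat, Nat.reduceSub]
    field_simp
    ring
  rw [intervalIntegral.integral_eq_sub_of_hasDerivAt (fun y _ => hd y)]
  · simp only [div_self hε.ne', zero_div]
    ring
  · apply Continuous.intervalIntegrable
    unfold quarticPoly
    fun_prop

lemma integral_one_sub_quarticPoly_mul {ε : ℝ} (hε : 0 < ε) (a m : ℝ) :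
    ∫ y in (-ε)..0, (1 - quarticPoly (y / ε)) * (-m * y + a) =
      5 / 32 * a * ε + m * ε^2 / 28 := by
  have := intervalIntegral.integral_comp_neg (a := 0) (b := ε)
    (fun y => (1 - quarticPoly (y / ε)) * (-m * y + a))
  rw [neg_zero] at this
  rw [← this]
  have := integral_quarticPoly_mul hε a (-m)
  simp only [one_sub_quarticPoly, neg_div, neg_neg, mul_neg, neg_mul] at this ⊢
  rw [this]
  ring

/-- Let `Γ_ε` be the quartic-kernel smoothed indicator and `Y` a real
random variable with density `h` such that `h(y) ≥ -m₁ y + h 0` on `(-ε, 0]` and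
`h(y) ≤ -m₂ y + h 0` on `[0, ε)` with `m₁, m₂ > 0`. Then
`P(Y ≤ 0) - E[Γ_ε(Y)] ≥ (m₁ + m₂) ε² / 28`. -/
theorem smoothing_gap_lower_bound
    {Ω : Type*} [MeasurableSpace Ω] (μ : Measure Ω) [IsProbabilityMeasure μ]
    (Y : Ω → ℝ) (hY : Measurable Y)
    (ε : ℝ) (hε : 0 < ε)
    (h : ℝ → ℝ) (hhmeas : Measurable h) (hhnonneg : ∀ y, 0 ≤ h y)
    (hdensity : Measure.map Y μ = volume.withDensity fun y => ENNReal.ofReal (h y))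
    (m₁ m₂ : ℝ) (hm₁ : 0 < m₁) (hm₂ : 0 < m₂)
    (hlow : ∀ y ∈ Set.Ioc (-ε) (0 : ℝ), -m₁ * y + h 0 ≤ h y)
    (hupp : ∀ y ∈ Set.Ico (0 : ℝ) ε, h y ≤ -m₂ * y + h 0) :
    (m₁ + m₂) * ε^2 / 28 ≤ (μ {ω | Y ω ≤ 0}).toReal - ∫ ω, quarticInd ε (Y ω) ∂μ := by
  set g : ℝ → ℝ := fun y => (Set.Iic (0 : ℝ)).indicator 1 y - quarticInd ε y with hg
  have hgm : Measurable g :=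
    (measurable_one.indicator measurableSet_Iic).sub (measurable_quarticInd ε)
  have hbound (y : ℝ) : ‖quarticInd ε y‖ ≤ 1 := by
    have := quarticInd_mem_Icc hε y
    rw [Real.norm_of_nonneg this.1]
    exact this.2
  have hind : Integrable ((Set.Iic (0 : ℝ)).indicator (1 : ℝ → ℝ)) (μ.map Y) := by
    have := Measure.isProbabilityMeasure_map (μ := μ) hY.aemeasurable
    exact (integrable_const (1 : ℝ)).indicator measurableSet_Iic
  have hquart : Integrable (quarticInd ε) (μ.map Y) := by
    have := Measure.isProbabilityMeasure_map (μ := μ) hY.aemeasurable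
    exact .of_bound (measurable_quarticInd ε).aestronglyMeasurable 1 (.of_forall hbound)
  have hgap : (μ {ω | Y ω ≤ 0}).toReal - ∫ ω, quarticInd ε (Y ω) ∂μ = ∫ y, h y * g y := by
    rw [← integral_map hY.aemeasurable (measurable_quarticInd ε).aestronglyMeasurable]
    have hP : (μ {ω | Y ω ≤ 0}).toReal
        = ∫ y, (Set.Iic (0 : ℝ)).indicator (1 : ℝ → ℝ) y ∂(μ.map Y) := by
      rw [integral_indicator_one measurableSet_Iic, measureReal_def,
        Measure.map_apply hY measurableSet_Iic]
      rfl
    rw [hP, ← integral_sub hind hquart, hdensity,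
      integral_withDensity_eq_integral_toReal_smul hhmeas.ennreal_ofReal
        (.of_forall fun _ => ENNReal.ofReal_lt_top)]
    simp [hg, ENNReal.toReal_ofReal, hhnonneg]
  have hgi : Integrable (fun y => h y * g y) := by
    have := hind.sub hquart
    rw [hdensity, integrable_withDensity_iff_integrable_smul' hhmeas.ennreal_ofReal
      (.of_forall fun _ => ENNReal.ofReal_lt_top)] at this
    simpa [hg, ENNReal.toReal_ofReal, hhnonneg] using this
  set p₁ : ℝ → ℝ := fun y => (1 - quarticPoly (y / ε)) * (-m₁ * y + h 0) with hp₁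
  set p₂ : ℝ → ℝ := fun y => quarticPoly (y / ε) * (-m₂ * y + h 0) with hp₂
  have hi₁ : Integrable ((Set.Ioc (-ε) 0).indicator p₁) := by
    rw [integrable_indicator_iff measurableSet_Ioc]
    refine Continuous.integrableOn_Ioc ?_
    unfold p₁ quarticPoly
    fun_prop
  have hi₂ : Integrable ((Set.Ioc 0 ε).indicator p₂) := by
    rw [integrable_indicator_iff measurableSet_Ioc]
    refine Continuous.integrableOn_Ioc ?_
    unfold p₂ quarticPoly
    fun_prop
  have hle (y : ℝ) :
      (Set.Ioc (-ε) 0).indicator p₁ y - (Set.Ioc 0 ε).indicator p₂ y ≤ h y * g y := by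
    rcases le_or_gt y (-ε) with h₁ | h₁
    · have h0 : y ≤ 0 := by linarith
      simp [hg, quarticInd_of_le h₁, h0, h₁.not_gt, h0.not_gt]
    rcases lt_or_ge ε y with h₂ | h₂
    · have h0 : 0 < y := by linarith
      simp [hg, quarticInd_of_lt hε h₂, h0.not_ge, h₂.not_ge]
    have hΓ := quarticInd_mem_Icc hε y
    have hΓp := quarticInd_eq_quarticPoly hε h₁ h₂
    rcases le_or_gt y 0 with h0 | h0
    · simp only [hg, hp₁, hp₂, Set.indicator, Set.mem_Ioc, Set.mem_Iic, h₁, h0, h0.not_gt, and_self,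
        false_and, if_true, if_false, ← hΓp, Pi.one_apply, sub_zero]
      nlinarith [mul_le_mul_of_nonneg_left (hlow y ⟨h₁, h0⟩) (sub_nonneg.2 hΓ.2)]
    · simp only [hg, hp₁, hp₂, Set.indicator, Set.mem_Ioc, Set.mem_Iic, h₂, h0, h0.not_ge, and_self,
        and_false, if_true, if_false, ← hΓp, zero_sub]
      rcases h₂.lt_or_eq with h₂ | rfl
      · nlinarith [mul_le_mul_of_nonneg_left (hupp y ⟨h0.le, h₂⟩) hΓ.1]
      · simp [quarticInd, h₁.not_ge]
  have hmono := integral_mono (hi₁.sub hi₂) hgi hle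
  rw [integral_sub' hi₁ hi₂, integral_indicator measurableSet_Ioc,
    integral_indicator measurableSet_Ioc, ← intervalIntegral.integral_of_le (by linarith),
    ← intervalIntegral.integral_of_le hε.le, integral_one_sub_quarticPoly_mul hε,
    integral_quarticPoly_mul hε] at hmono
  rw [hgap]
  linarith
end

section
/- Let ε > 0, α ∈ (0,1), N ∈ ℕ with (1−α)·N ∉ ℤ, Γ_ε the quartic-kernel smoothed indicator, and Q_ε : ℝ^N → ℝ the map sending z to the unique root Q of Σ_{i=1}^N Γ_ε(z_i − Q) = (1−α)·N. If z, ẑ ∈ ℝ^N satisfy z_i ≤ ẑ_i for all i, then Q_ε(z) ≤ Q_ε(ẑ). -/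
/-- The polynomial profile of `quarticInd` on the transition region, in the scaled variable. -/
noncomputable def quarticProfile (t : ℝ) : ℝ :=
  (15/16) * (-(1/5) * t^5 + (2/3) * t^3 - t + 8/15)

theorem hasDerivAt_quarticProfile (t : ℝ) :
    HasDerivAt quarticProfile (-(15/16) * (1 - t^2)^2) t := by
  have h := ((((hasDerivAt_pow 5 t).const_mul (-(1/5) : ℝ)).add
    ((hasDerivAt_pow 3 t).const_mul (2/3 : ℝ))).sub (hasDerivAt_id t)).add_const (8/15 : ℝ)
  refine (h.const_mul (15/16 : ℝ)).congr_deriv ?_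
  norm_num
  ring

theorem strictAntiOn_quarticProfile : StrictAntiOn quarticProfile (Set.Icc (-1) 1) := by
  refine strictAntiOn_of_deriv_neg (convex_Icc _ _)
    (fun t _ => (hasDerivAt_quarticProfile t).continuousAt.continuousWithinAt) fun t ht => ?_
  rw [interior_Icc] at ht
  rw [(hasDerivAt_quarticProfile t).deriv]
  have : 0 < 1 - t^2 := by nlinarith [ht.1, ht.2]
  have : 0 < (1 - t^2)^2 := by positivity
  linarith

theorem quarticInd_eq_quarticProfile {ε : ℝ} (hε : 0 < ε) (y : ℝ) :
    quarticInd ε y = quarticProfile (max (-1) (min 1 (y / ε))) := by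
  unfold quarticInd
  split_ifs with h₁ h₂
  · have h : y / ε ≤ -1 := by rw [div_le_iff₀ hε]; linarith
    rw [min_eq_right (by linarith), max_eq_left h]
    norm_num [quarticProfile]
  · have h : -1 ≤ y / ε := by rw [le_div_iff₀ hε]; linarith
    have h' : y / ε ≤ 1 := by rw [div_le_iff₀ hε]; linarith
    rw [min_eq_right h', max_eq_right h, quarticProfile]
  · have h : 1 ≤ y / ε := by rw [le_div_iff₀ hε]; linarith
    rw [min_eq_left h, max_eq_right (by norm_num)]
    norm_num [quarticProfile]

theorem antitone_quarticInd {ε : ℝ} (hε : 0 < ε) : Antitone (quarticInd ε) := by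
  intro x y hxy
  rw [quarticInd_eq_quarticProfile hε, quarticInd_eq_quarticProfile hε]
  exact strictAntiOn_quarticProfile.antitoneOn ⟨le_max_left _ _, by simp⟩
    ⟨le_max_left _ _, by simp⟩ (by gcongr)

theorem quarticInd_lt_of_mem_Ioo {ε x y : ℝ} (hε : 0 < ε) (hx : x ∈ Set.Ioo (-ε) ε)
    (hxy : x < y) : quarticInd ε y < quarticInd ε x := by
  rw [quarticInd_eq_quarticProfile hε, quarticInd_eq_quarticProfile hε]
  refine strictAntiOn_quarticProfile ⟨le_max_left _ _, by simp⟩ ⟨le_max_left _ _, by simp⟩ ?_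
  have h : -1 < x / ε := by rw [lt_div_iff₀ hε]; linarith [hx.1]
  have h' : x / ε < 1 := by rw [div_lt_iff₀ hε]; linarith [hx.2]
  rw [min_eq_right h'.le, max_eq_right h.le]
  exact lt_max_of_lt_right (lt_min h' (by gcongr))

theorem exists_mem_Ioo_of_sum_quarticInd_ne_intCast {ι : Type*} {s : Finset ι} {ε : ℝ}
    {w : ι → ℝ} (h : ∀ k : ℤ, ∑ i ∈ s, quarticInd ε (w i) ≠ k) :
    ∃ i ∈ s, w i ∈ Set.Ioo (-ε) ε := by
  by_contra! hw
  refine h (∑ i ∈ s, if w i ≤ -ε then 1 else 0) ?_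
  push_cast
  refine Finset.sum_congr rfl fun i hi => ?_
  by_cases h₁ : w i ≤ -ε
  · simp [quarticInd, h₁]
  · have h₂ : ¬ w i < ε := fun h₂ => hw i hi ⟨not_le.mp h₁, h₂⟩
    simp [quarticInd, h₁, h₂]

/-- Monotonicity of the smoothed quantile map: if `Q_ε : ℝ^N → ℝ`
sends each `z` to the (unique) root `Q` of `∑ i, Γ_ε (z i - Q) = (1-α)·N`
(with `(1-α)·N ∉ ℤ`), then `z ≤ ẑ` componentwise implies `Q_ε(z) ≤ Q_ε(ẑ)`. -/
theorem smoothed_quantile_monotone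
    (ε α : ℝ) (hε : 0 < ε) (hα : α ∈ Set.Ioo (0 : ℝ) 1) (N : ℕ)
    (hNotInt : ∀ k : ℤ, (1 - α) * (N : ℝ) ≠ (k : ℝ))
    (Q : (Fin N → ℝ) → ℝ)
    (hQ : ∀ z : Fin N → ℝ, ∑ i, quarticInd ε (z i - Q z) = (1 - α) * (N : ℝ))
    (z zhat : Fin N → ℝ) (hle : ∀ i, z i ≤ zhat i) :
    Q z ≤ Q zhat := by
  by_contra! hlt
  obtain ⟨j, hj, hmem⟩ := exists_mem_Ioo_of_sum_quarticInd_ne_intCast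
    (s := Finset.univ) (w := fun i => z i - Q z) fun k => (hQ z).trans_ne (hNotInt k)
  have hshift : ∀ i, z i - Q z < zhat i - Q zhat := fun i => by linarith [hle i]
  have hsum : ∑ i, quarticInd ε (zhat i - Q zhat) < ∑ i, quarticInd ε (z i - Q z) :=
    Finset.sum_lt_sum (fun i _ => antitone_quarticInd hε (hshift i).le)
      ⟨j, hj, quarticInd_lt_of_mem_Ioo hε hmem (hshift j)⟩
  exact hsum.ne ((hQ zhat).trans (hQ z).symm)
end

section
/- Let f : ℝ^n → ℝ, g : ℝ^n → ℝ^p, and for fixed sample points ξ_1, …, ξ_N ∈ ℝ^s let c(·, ξ_i) : ℝ^n → ℝ^m. Define C^N(x) ∈ ℝ^N by [C^N(x)]_i = max_{j=1,…,m} c_j(x, ξ_i), and let Q_ε : ℝ^N → ℝ be the smoothed quantile function (the unique root map for the quartic-kernel smoothed indicator with (1−α)N ∉ ℤ), which is monotone nondecreasing in each coordinate. Suppose x* is a local minimizer of f over the set {x : g(x) ≤ 0, Q_ε(C^N(x)) ≤ 0}. Then (x*, C^N(x*)) is a local minimizer of f(x) over the lifted feasible set {(x, z) ∈ ℝ^n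 × ℝ^N : g(x) ≤ 0, c_j(x, ξ_i) ≤ z_i for all i = 1,…,N and j = 1,…,m, Q_ε(z) ≤ 0}. -/
/-- If `x*` is a local minimizer of `f` over
`{x : g(x) ≤ 0, Q_ε(C^N(x)) ≤ 0}`, where `[C^N(x)]_i = max_j c_j(x, ξ_i)` and the
smoothed quantile map `Q_ε` (the unique-root map for the quartic smoothed indicator,
`(1-α)N ∉ ℤ`) is monotone nondecreasing in each coordinate, then `(x*, C^N(x*))` is a
local minimizer of `f(x)` over the lifted feasible set
`{(x,z) : g(x) ≤ 0, c_j(x,ξ_i) ≤ z_i ∀ i j, Q_ε(z) ≤ 0}`. -/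
theorem lifted_local_minimizer
    {n p m N : ℕ} [NeZero m]
    (f : (Fin n → ℝ) → ℝ) (g : Fin p → (Fin n → ℝ) → ℝ)
    (c : Fin N → Fin m → (Fin n → ℝ) → ℝ)
    (ε α : ℝ) (hε : 0 < ε) (hα : α ∈ Set.Ioo (0 : ℝ) 1)
    (hNotInt : ∀ k : ℤ, (1 - α) * (N : ℝ) ≠ (k : ℝ))
    (Q : (Fin N → ℝ) → ℝ)
    (hQ : ∀ z : Fin N → ℝ, ∑ i, quarticInd ε (z i - Q z) = (1 - α) * (N : ℝ))
    (hQmono : Monotone Q)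
    (CN : (Fin n → ℝ) → Fin N → ℝ)
    (hCN : ∀ x i, CN x i = Finset.univ.sup' Finset.univ_nonempty fun j => c i j x)
    (xstar : Fin n → ℝ)
    (hfeas : xstar ∈ {x : Fin n → ℝ | (∀ j, g j x ≤ 0) ∧ Q (CN x) ≤ 0})
    (hloc : IsLocalMinOn f {x : Fin n → ℝ | (∀ j, g j x ≤ 0) ∧ Q (CN x) ≤ 0} xstar) :
    (xstar, CN xstar) ∈ {q : (Fin n → ℝ) × (Fin N → ℝ) |
        (∀ j, g j q.1 ≤ 0) ∧ (∀ i j, c i j q.1 ≤ q.2 i) ∧ Q q.2 ≤ 0} ∧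
    IsLocalMinOn (fun q : (Fin n → ℝ) × (Fin N → ℝ) => f q.1)
      {q : (Fin n → ℝ) × (Fin N → ℝ) |
        (∀ j, g j q.1 ≤ 0) ∧ (∀ i j, c i j q.1 ≤ q.2 i) ∧ Q q.2 ≤ 0}
      (xstar, CN xstar) := by
  have le_CN : ∀ x i j, c i j x ≤ CN x i := fun x i j => by
    rw [hCN]
    exact Finset.le_sup' (fun j => c i j x) (Finset.mem_univ j)
  refine ⟨⟨hfeas.1, le_CN xstar, hfeas.2⟩, ?_⟩
  refine Filter.Tendsto.eventually (f := Prod.fst) (tendsto_nhdsWithin_iff.2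
    ⟨(continuous_fst.tendsto (xstar, CN xstar)).mono_left nhdsWithin_le_nhds, ?_⟩) hloc
  filter_upwards [self_mem_nhdsWithin] with q hq
  refine ⟨hq.1, (hQmono fun i => ?_).trans hq.2.2⟩
  rw [hCN]
  exact Finset.sup'_le _ _ fun j _ => hq.2.1 i j
end

section
/- Let f : ℝ^n → ℝ and g : ℝ^n → ℝ^p be differentiable with Lipschitz continuous gradients, let ξ_1, …, ξ_N ∈ ℝ^s be fixed, and let c(·, ξ_i) : ℝ^n → ℝ^m be differentiable with constants L, L' > 0 such that |c(x,ξ_i) − c(y,ξ_i)| ≤ L‖x−y‖ and |∇c(x,ξ_i) − ∇c(y,ξ_i)| ≤ L'‖x−y‖ for all x, y and all i. Let Q_ε : ℝ^N → ℝ be the smoothed quantile function (differentiable with bounded, Lipschitz continuous gradient), π > 0, and define the penalty function φ_π(x) = f(x) + π(‖[g(x)]⁺‖₁ + [Q_ε(C^N(x))]⁺) where [C^N(x)]_i = max_j c_j(x,ξ_i) and [u]⁺ denotes the componentwise positive part. For x, d ∈ ℝ^n and a symmetric matrix H ∈ ℝ^{n×n}, define the model m(x,H;d) = f(x) + ∇f(x)ᵀd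 + (1/2)dᵀHd + π(‖[g(x) + ∇g(x)ᵀd]⁺‖₁ + [Q_ε(C^N(x)) + ∇Q_ε(C^N(x))ᵀ(C̃^N(x;d) − C^N(x))]⁺), where [C̃^N(x;d)]_i = max_j {c_j(x,ξ_i) + ∇c_j(x,ξ_i)ᵀd}. Then for every L_H > 0 there exists κ > 0 such that |φ_π(x+d) − m(x,H;d)| ≤ κ‖d‖² for all x, d ∈ ℝ^n and all symmetric H with ‖H‖ ≤ L_H. -/
open Matrix

/-- A first-order Taylor bound: if the derivative of `f` is `K`-Lipschitz, then the linearization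
error of `f` at `x` is at most `|K| ‖d‖²`. -/
lemma abs_sub_sub_fderiv_le {E : Type*} [NormedAddCommGroup E] [NormedSpace ℝ E] {f : E → ℝ}
    (hf : Differentiable ℝ f) {K : ℝ}
    (hK : ∀ x y, ‖fderiv ℝ f x - fderiv ℝ f y‖ ≤ K * ‖x - y‖) (x d : E) :
    |f (x + d) - (f x + fderiv ℝ f x d)| ≤ |K| * ‖d‖ ^ 2 := by
  have hbound : ∀ z ∈ segment ℝ x (x + d), ‖fderiv ℝ f z - fderiv ℝ f x‖ ≤ |K| * ‖d‖ := by
    intro z hz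
    have hzx : ‖z - x‖ ≤ ‖d‖ := by
      simpa using norm_sub_le_of_mem_segment hz
    calc ‖fderiv ℝ f z - fderiv ℝ f x‖ ≤ K * ‖z - x‖ := hK z x
      _ ≤ |K| * ‖d‖ := by gcongr; exact le_abs_self K
  have h := (convex_segment x (x + d)).norm_image_sub_le_of_norm_fderiv_le'
    (fun z _ => hf z) hbound (left_mem_segment ℝ x (x + d)) (right_mem_segment ℝ x (x + d))
  rw [add_sub_cancel_left, Real.norm_eq_abs] at h
  calc |f (x + d) - (f x + fderiv ℝ f x d)| = |f (x + d) - f x - fderiv ℝ f x d| := by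
        rw [sub_sub]
    _ ≤ |K| * ‖d‖ * ‖d‖ := h
    _ = |K| * ‖d‖ ^ 2 := by ring

/-- The finite maximum is nonexpansive for the sup distance. -/
lemma abs_sup'_sub_sup'_le {ι : Type*} {s : Finset ι} (hs : s.Nonempty) {a b : ι → ℝ} {δ : ℝ}
    (h : ∀ j ∈ s, |a j - b j| ≤ δ) : |s.sup' hs a - s.sup' hs b| ≤ δ := by
  rw [abs_sub_le_iff]
  constructor
  · rw [sub_le_iff_le_add]
    refine Finset.sup'_le _ _ fun j hj => ?_
    linarith [(abs_le.mp (h j hj)).2, Finset.le_sup' b hj]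
  · rw [sub_le_iff_le_add]
    refine Finset.sup'_le _ _ fun j hj => ?_
    linarith [(abs_le.mp (h j hj)).1, Finset.le_sup' a hj]

/-- The positive part is nonexpansive. -/
lemma abs_max_zero_sub_max_zero_le (a b : ℝ) : |max 0 a - max 0 b| ≤ |a - b| := by
  simpa using abs_max_sub_max_le_max 0 a 0 b

/-- The dot product is bounded by the dimension times the product of the sup norms. -/
lemma abs_dotProduct_le {n : ℕ} (v w : Fin n → ℝ) : |v ⬝ᵥ w| ≤ n * (‖v‖ * ‖w‖) := by
  calc |v ⬝ᵥ w| ≤ ∑ i, |v i * w i| := Finset.abs_sum_le_sum_abs _ _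
    _ ≤ ∑ _i : Fin n, ‖v‖ * ‖w‖ := by
        refine Finset.sum_le_sum fun i _ => ?_
        rw [abs_mul]
        exact mul_le_mul (norm_le_pi_norm v i) (norm_le_pi_norm w i) (abs_nonneg _)
          (norm_nonneg _)
    _ = n * (‖v‖ * ‖w‖) := by simp

/-- The piecewise-quadratic model
`m(x,H;d) = f(x) + ∇f(x)ᵀd + ½ dᵀHd + π(‖[g(x)+∇g(x)ᵀd]⁺‖₁ + [Q_ε(C^N(x)) + ∇Q_ε(C^N(x))ᵀ(C̃^N(x;d)-C^N(x))]⁺)`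
is a first-order model of the exact `ℓ₁`-penalty function
`φ_π(x) = f(x) + π(‖[g(x)]⁺‖₁ + [Q_ε(C^N(x))]⁺)`: for every `L_H > 0` there is `κ > 0`
with `|φ_π(x+d) - m(x,H;d)| ≤ κ‖d‖²` for all `x, d` and all symmetric `H` with
`‖H‖ ≤ L_H`. -/
theorem penalty_first_order_model
    {n p m N : ℕ} [NeZero m]
    (f : (Fin n → ℝ) → ℝ) (hf : Differentiable ℝ f)
    (Lf : ℝ) (hfLip : ∀ x y : Fin n → ℝ, ‖fderiv ℝ f x - fderiv ℝ f y‖ ≤ Lf * ‖x - y‖)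
    (g : Fin p → (Fin n → ℝ) → ℝ) (hg : ∀ j, Differentiable ℝ (g j))
    (Lg : ℝ)
    (hgLip : ∀ j, ∀ x y : Fin n → ℝ,
      ‖fderiv ℝ (g j) x - fderiv ℝ (g j) y‖ ≤ Lg * ‖x - y‖)
    (c : Fin N → Fin m → (Fin n → ℝ) → ℝ) (hc : ∀ i j, Differentiable ℝ (c i j))
    (L L' : ℝ) (hL : 0 < L) (hL' : 0 < L')
    (hcLip : ∀ i j, ∀ x y : Fin n → ℝ, |c i j x - c i j y| ≤ L * ‖x - y‖)
    (hcGradLip : ∀ i j, ∀ x y : Fin n → ℝ,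
      ‖fderiv ℝ (c i j) x - fderiv ℝ (c i j) y‖ ≤ L' * ‖x - y‖)
    (Q : (Fin N → ℝ) → ℝ) (hQ : Differentiable ℝ Q)
    (BQ : ℝ) (hQbdd : ∀ z : Fin N → ℝ, ‖fderiv ℝ Q z‖ ≤ BQ)
    (LQ : ℝ)
    (hQLip : ∀ z w : Fin N → ℝ, ‖fderiv ℝ Q z - fderiv ℝ Q w‖ ≤ LQ * ‖z - w‖)
    (π : ℝ) (hπ : 0 < π)
    -- the componentwise maximum C^N and its componentwise linearization C̃^N:
    (CN : (Fin n → ℝ) → Fin N → ℝ)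
    (hCN : ∀ x i, CN x i = Finset.univ.sup' Finset.univ_nonempty fun j => c i j x)
    (Ct : (Fin n → ℝ) → (Fin n → ℝ) → Fin N → ℝ)
    (hCt : ∀ x d i, Ct x d i = Finset.univ.sup' Finset.univ_nonempty
      fun j => c i j x + fderiv ℝ (c i j) x d)
    -- the penalty function φ_π and the model m(x,H;d):
    (φ : (Fin n → ℝ) → ℝ)
    (hφ : ∀ x, φ x = f x + π * ((∑ j, max 0 (g j x)) + max 0 (Q (CN x))))
    (mdl : (Fin n → ℝ) → Matrix (Fin n) (Fin n) ℝ → (Fin n → ℝ) → ℝ)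
    (hmdl : ∀ x H d, mdl x H d =
      f x + fderiv ℝ f x d + (1/2) * (d ⬝ᵥ H.mulVec d) +
        π * ((∑ j, max 0 (g j x + fderiv ℝ (g j) x d)) +
          max 0 (Q (CN x) + fderiv ℝ Q (CN x) (Ct x d - CN x)))) :
    ∀ LH : ℝ, 0 < LH → ∃ κ : ℝ, 0 < κ ∧
      ∀ (x d : Fin n → ℝ) (H : Matrix (Fin n) (Fin n) ℝ),
        H.IsSymm → (∀ v : Fin n → ℝ, ‖H.mulVec v‖ ≤ LH * ‖v‖) →
        |φ (x + d) - mdl x H d| ≤ κ * ‖d‖^2 := by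
  intro LH hLH
  have hBQ : 0 ≤ BQ := (norm_nonneg _).trans (hQbdd 0)
  refine ⟨|Lf| + n * LH + π * (p * |Lg| + (|LQ| * L ^ 2 + BQ * L')) + 1, by positivity, ?_⟩
  intro x d H _ hH
  have hfd := abs_sub_sub_fderiv_le hf hfLip x d
  have hquad : |1 / 2 * (d ⬝ᵥ H.mulVec d)| ≤ n * LH * ‖d‖ ^ 2 := by
    have h1 : |d ⬝ᵥ H.mulVec d| ≤ n * LH * ‖d‖ ^ 2 := by
      calc |d ⬝ᵥ H.mulVec d| ≤ n * (‖d‖ * ‖H.mulVec d‖) := abs_dotProduct_le _ _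
        _ ≤ n * (‖d‖ * (LH * ‖d‖)) := by gcongr; exact hH d
        _ = n * LH * ‖d‖ ^ 2 := by ring
    rw [abs_mul, abs_of_pos (by norm_num : (0 : ℝ) < 1 / 2)]
    linarith [abs_nonneg (d ⬝ᵥ H.mulVec d)]
  have hgd : |(∑ j, max 0 (g j (x + d))) - ∑ j, max 0 (g j x + fderiv ℝ (g j) x d)|
      ≤ p * |Lg| * ‖d‖ ^ 2 := by
    rw [← Finset.sum_sub_distrib]
    calc _ ≤ ∑ j, |max 0 (g j (x + d)) - max 0 (g j x + fderiv ℝ (g j) x d)| :=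
          Finset.abs_sum_le_sum_abs _ _
      _ ≤ ∑ _j : Fin p, |Lg| * ‖d‖ ^ 2 := Finset.sum_le_sum fun j _ =>
          (abs_max_zero_sub_max_zero_le _ _).trans (abs_sub_sub_fderiv_le (hg j) (hgLip j) x d)
      _ = p * |Lg| * ‖d‖ ^ 2 := by simp [mul_assoc]
  have hCNd : ‖CN (x + d) - CN x‖ ≤ L * ‖d‖ := by
    refine (pi_norm_le_iff_of_nonneg (by positivity)).mpr fun i => ?_
    rw [Pi.sub_apply, hCN, hCN, Real.norm_eq_abs]
    exact abs_sup'_sub_sup'_le _ fun j _ => by simpa using hcLip i j (x + d) x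
  have hCtd : ‖CN (x + d) - Ct x d‖ ≤ L' * ‖d‖ ^ 2 := by
    refine (pi_norm_le_iff_of_nonneg (by positivity)).mpr fun i => ?_
    rw [Pi.sub_apply, hCN, hCt, Real.norm_eq_abs]
    refine abs_sup'_sub_sup'_le _ fun j _ => ?_
    simpa [abs_of_pos hL'] using abs_sub_sub_fderiv_le (hc i j) (hcGradLip i j) x d
  have hQd : |Q (CN (x + d)) - (Q (CN x) + fderiv ℝ Q (CN x) (Ct x d - CN x))|
      ≤ (|LQ| * L ^ 2 + BQ * L') * ‖d‖ ^ 2 := by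
    have h1 := abs_sub_sub_fderiv_le hQ hQLip (CN x) (CN (x + d) - CN x)
    rw [add_sub_cancel] at h1
    have h2 : |fderiv ℝ Q (CN x) (CN (x + d) - Ct x d)| ≤ BQ * (L' * ‖d‖ ^ 2) :=
      (fderiv ℝ Q (CN x)).le_of_opNorm_le_of_le (hQbdd _) hCtd
    have h3 : |LQ| * ‖CN (x + d) - CN x‖ ^ 2 ≤ |LQ| * (L * ‖d‖) ^ 2 := by gcongr
    have h4 : Q (CN (x + d)) - (Q (CN x) + fderiv ℝ Q (CN x) (Ct x d - CN x)) =
        (Q (CN (x + d)) - (Q (CN x) + fderiv ℝ Q (CN x) (CN (x + d) - CN x))) +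
          fderiv ℝ Q (CN x) (CN (x + d) - Ct x d) := by
      simp only [map_sub]; ring
    rw [h4]
    refine (abs_add_le _ _).trans ?_
    linarith
  have hpen := (abs_max_zero_sub_max_zero_le _ _).trans hQd
  rw [hφ, hmdl]
  set S := ∑ j, max 0 (g j (x + d))
  set S' := ∑ j, max 0 (g j x + fderiv ℝ (g j) x d)
  set q := max 0 (Q (CN (x + d)))
  set q' := max 0 (Q (CN x) + fderiv ℝ Q (CN x) (Ct x d - CN x))
  have hπd : |π * ((S - S') + (q - q'))| ≤
      π * (p * |Lg| * ‖d‖ ^ 2 + (|LQ| * L ^ 2 + BQ * L') * ‖d‖ ^ 2) := by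
    rw [abs_mul, abs_of_pos hπ]
    gcongr
    exact (abs_add_le _ _).trans (add_le_add hgd hpen)
  have hd := sq_nonneg ‖d‖
  rw [abs_le] at hfd hquad hπd ⊢
  constructor <;> linarith [hfd.1, hfd.2, hquad.1, hquad.2, hπd.1, hπd.2]
end

section
/- Let f : ℝ^n → ℝ, g : ℝ^n → ℝ^p, and (for fixed ξ_1,…,ξ_N ∈ ℝ^s) c(·,ξ_i) : ℝ^n → ℝ^m be differentiable, let Q_ε : ℝ^N → ℝ be the differentiable smoothed quantile function, and set [C^N(x)]_i = max_j c_j(x,ξ_i). Suppose (x*, z*, ν*, μ*, λ*) with z* = C^N(x*), ν* ∈ ℝ^p, μ*_i ∈ ℝ^m, λ* ∈ ℝ satisfies the KKT conditions of the lifted problem: ∇f(x*) + ∇g(x*)ν* + Σ_{i=1}^N ∇c(x*,ξ_i) μ*_i = 0; λ*·[∇Q_ε(z*)]_i = Σ_{j=1}^m [μ*_i]_j for every i; c(x*,ξ_i) ≤ z*_i·𝟙 for every i; Q_ε(z*) ≤ 0; (μ*_i)ᵀ(c(x*,ξ_i) − z*_i·𝟙) = 0 for every i; λ*·Q_ε(z*)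 = 0; λ* ≥ 0 and μ*_i ≥ 0 for every i; together with the KKT conditions associated with g (g(x*) ≤ 0, ν* ≥ 0, ν*ᵀg(x*) = 0). For each i define μ̄_i ∈ ℝ^m by [μ̄_i]_j = [μ*_i]_j / (λ*·[∇Q_ε(C^N(x*))]_i) when λ* ≠ 0 and [∇Q_ε(C^N(x*))]_i ≠ 0, and otherwise μ̄_i = e_j for some j with c_j(x*,ξ_i) = [C^N(x*)]_i; and define [C̄^N(x)]_i = μ̄_iᵀ c(x,ξ_i). Then (x*, ν*, λ*) is a KKT point of the smooth problem min f(x) subject to g(x) ≤ 0 and Q_ε(C̄^N(x)) ≤ 0; in particular [C̄^N(x*)]_i = z*_i for every i, Q_ε(C̄^N(x*)) ≤ 0, λ*·Q_ε(C̄^N(x*)) = 0, and ∇f(x*) + ∇g(x*)ν* + λ* Σ_{i=1}^N [∇Q_ε(C̄^N(x*))]_i ∇c(x*,ξ_i) μ̄_i = 0. -/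
/-- From a KKT point `(x*, z*, ν*, μ*, λ*)` of the lifted problem
(with `z* = C^N(x*)`, `[C^N(x)]_i = max_j c_j(x,ξ_i)`) one obtains, via the rescaled
multipliers `μ̄` and the smooth aggregate `[C̄^N(x)]_i = μ̄_iᵀ c(x,ξ_i)`, that
`(x*, ν*, λ*)` is a KKT point of the smooth problem
`min f(x) s.t. g(x) ≤ 0, Q_ε(C̄^N(x)) ≤ 0`; in particular `C̄^N(x*) = z*`,
`Q_ε(C̄^N(x*)) ≤ 0`, `λ*·Q_ε(C̄^N(x*)) = 0`, and the Lagrangian gradient vanishes. -/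
theorem kkt_point_of_smooth_problem
    {n p m N : ℕ} [NeZero m]
    (f : (Fin n → ℝ) → ℝ) (g : Fin p → (Fin n → ℝ) → ℝ)
    (c : Fin N → Fin m → (Fin n → ℝ) → ℝ)
    (hf : Differentiable ℝ f) (hg : ∀ k, Differentiable ℝ (g k))
    (hc : ∀ i j, Differentiable ℝ (c i j))
    (Q : (Fin N → ℝ) → ℝ) (hQ : Differentiable ℝ Q)
    (CN : (Fin n → ℝ) → Fin N → ℝ)
    (hCN : ∀ x i, CN x i = Finset.univ.sup' Finset.univ_nonempty fun j => c i j x)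
    (xstar : Fin n → ℝ) (zstar : Fin N → ℝ) (hzstar : zstar = CN xstar)
    (ν : Fin p → ℝ) (μ : Fin N → Fin m → ℝ) (lam : ℝ)
    -- KKT conditions of the lifted problem:
    (hstatx : ∀ d : Fin n → ℝ,
      fderiv ℝ f xstar d + (∑ k, ν k * fderiv ℝ (g k) xstar d) +
        (∑ i, ∑ j, μ i j * fderiv ℝ (c i j) xstar d) = 0)
    (hstatz : ∀ i, lam * fderiv ℝ Q zstar (Pi.single i 1) = ∑ j, μ i j)
    (hfeasc : ∀ i j, c i j xstar ≤ zstar i)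
    (hfeasQ : Q zstar ≤ 0)
    (hcompc : ∀ i, ∑ j, μ i j * (c i j xstar - zstar i) = 0)
    (hcompQ : lam * Q zstar = 0)
    (hlam : 0 ≤ lam) (hμ : ∀ i j, 0 ≤ μ i j)
    -- KKT conditions associated with g:
    (hfeasg : ∀ k, g k xstar ≤ 0) (hν : ∀ k, 0 ≤ ν k)
    (hcompg : ∑ k, ν k * g k xstar = 0)
    -- rescaled multipliers μ̄:
    (μbar : Fin N → Fin m → ℝ)
    (hμbar₁ : ∀ i, lam ≠ 0 → fderiv ℝ Q (CN xstar) (Pi.single i 1) ≠ 0 →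
      ∀ j, μbar i j = μ i j / (lam * fderiv ℝ Q (CN xstar) (Pi.single i 1)))
    (hμbar₂ : ∀ i, (lam = 0 ∨ fderiv ℝ Q (CN xstar) (Pi.single i 1) = 0) →
      ∃ j, c i j xstar = CN xstar i ∧ μbar i = Pi.single j 1)
    -- the aggregated smooth constraint function C̄:
    (Cbar : (Fin n → ℝ) → Fin N → ℝ)
    (hCbar : ∀ x i, Cbar x i = ∑ j, μbar i j * c i j x) :
    (∀ i, Cbar xstar i = zstar i) ∧
    Q (Cbar xstar) ≤ 0 ∧
    lam * Q (Cbar xstar) = 0 ∧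
    ∀ d : Fin n → ℝ,
      fderiv ℝ f xstar d + (∑ k, ν k * fderiv ℝ (g k) xstar d) +
        lam * (∑ i, fderiv ℝ Q (Cbar xstar) (Pi.single i 1) *
          (∑ j, μbar i j * fderiv ℝ (c i j) xstar d)) = 0 := by
  subst hzstar
  have hscale : ∀ i j,
      lam * fderiv ℝ Q (CN xstar) (Pi.single i 1) * μbar i j = μ i j := by
    intro i j
    by_cases h : lam * fderiv ℝ Q (CN xstar) (Pi.single i 1) = 0
    · have hsum : ∑ j, μ i j = 0 := by rw [← hstatz i, h]
      have hzero := (Finset.sum_eq_zero_iff_of_nonneg fun j _ => hμ i j).mp hsum j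
        (Finset.mem_univ j)
      rw [h, hzero, zero_mul]
    · rw [hμbar₁ i (left_ne_zero_of_mul h) (right_ne_zero_of_mul h) j, mul_div_cancel₀ _ h]
  have hvalue : Cbar xstar = CN xstar := by
    funext i
    rw [hCbar]
    by_cases h : lam * fderiv ℝ Q (CN xstar) (Pi.single i 1) = 0
    · obtain ⟨j, hj, hbar⟩ := hμbar₂ i (mul_eq_zero.mp h)
      simp [hbar, Pi.single_apply, hj]
    · have hcomp : ∑ j, μ i j * c i j xstar = (∑ j, μ i j) * CN xstar i := by
        have := hcompc i
        simp only [mul_sub, Finset.sum_sub_distrib, ← Finset.sum_mul] at this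
        exact sub_eq_zero.mp this
      apply mul_left_cancel₀ h
      simp only [Finset.mul_sum, ← mul_assoc, hscale]
      rw [hcomp, hstatz i]
  refine ⟨fun i => congrFun hvalue i, hvalue ▸ hfeasQ, hvalue ▸ hcompQ, fun d => ?_⟩
  rw [hvalue, ← hstatx d]
  simp only [Finset.mul_sum, ← mul_assoc, hscale]
end
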